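/- arXiv:1610.07546 — 2 statements merged into one kernel-verified Lean document; each statement's English description precedes it below -/
import Mathlib

section
/- Let C be as in the 2-Calabi–Yau setup and T a cluster-tilting object of C. For any objects X and Y of C, every homomorphism of right End_C(T)-modules φ: Hom_C(T, ΣX) → Hom_C(T, ΣY) is of the form φ(g) = (Σf) ∘ g for some morphism f: X → Y in C. (Fullness of the functor H = Hom_C(T, Σ−).) -/
/-!
STATEMENT 9 (Keller–Reiten / Buan–Marsh–Reiten): In the 2-Calabi–Yau setup, let `T`
be a cluster-tilting object.  Every homomorphism of right `End_C(T)`-modules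
`φ : Hom_C(T, ΣX) → Hom_C(T, ΣY)` (an additive map commuting with precomposition by
endomorphisms of `T`) is of the form `φ(g) = (Σf) ∘ g` for some `f : X ⟶ Y`.
(Fullness of `H = Hom_C(T, Σ−)`.)

Krull–Schmidt is encoded as idempotent completeness, which, together with
Hom-finiteness over the field `k`, is equivalent to the Krull–Schmidt property.
-/
open CategoryTheory Limits Pretriangulated

universe v u

section Setup

variable {C : Type u} [Category.{v} C] [Preadditive C] [HasZeroObject C]
  [HasShift C ℤ] [∀ n : ℤ, (shiftFunctor C n).Additive] [Pretriangulated C]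
  [HasFiniteBiproducts C]

/-- `X` belongs to `add T`: it is a direct summand of a finite direct sum of copies
of `T`. -/
def InAdd (T X : C) : Prop :=
  ∃ (n : ℕ) (Y : C), Nonempty ((X ⊞ Y) ≅ ⨁ (fun _ : Fin n => T))

/-- `T` is rigid if `Hom(T, ΣT) = 0`. -/
def IsRigid (T : C) : Prop := ∀ f : T ⟶ T⟦(1 : ℤ)⟧, f = 0

/-- `T` is cluster-tilting if it is rigid and every object `X` with `Hom(T, ΣX) = 0`
lies in `add T`. -/
def IsClusterTilting (T : C) : Prop :=
  IsRigid T ∧ ∀ X : C, (∀ f : T ⟶ X⟦(1 : ℤ)⟧, f = 0) → InAdd T X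

end Setup

/-- A 2-Calabi–Yau structure: a bifunctorial isomorphism
`Hom(X, ΣY) ≅ (Hom(Y, ΣX))^*`. -/
structure TwoCYStructure (k : Type*) [Field k] (C : Type u) [Category.{v} C]
    [Preadditive C] [Linear k C] [HasShift C ℤ] where
  pair : ∀ X Y : C, (X ⟶ Y⟦(1 : ℤ)⟧) →ₗ[k] Module.Dual k (Y ⟶ X⟦(1 : ℤ)⟧)
  bijective : ∀ X Y : C, Function.Bijective (pair X Y)
  nat_left : ∀ {X X' Y : C} (u : X' ⟶ X) (α : X ⟶ Y⟦(1 : ℤ)⟧) (β : Y ⟶ X'⟦(1 : ℤ)⟧),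
    pair X' Y (u ≫ α) β = pair X Y α (β ≫ u⟦(1 : ℤ)⟧')
  nat_right : ∀ {X Y Y' : C} (v : Y ⟶ Y') (α : X ⟶ Y⟦(1 : ℤ)⟧) (β : Y' ⟶ X⟦(1 : ℤ)⟧),
    pair X Y' (α ≫ v⟦(1 : ℤ)⟧') β = pair X Y α (v ≫ β)

section FinitePower

variable {C : Type u} [Category.{v} C] [Preadditive C] [HasFiniteBiproducts C]

/-- If the morphism spaces out of `T` are finite-dimensional, every object has a right
approximation by a finite power of `T`. -/
theorem exists_power_approximation (k : Type*) [Field k] [Linear k C] (T A : C)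
    [FiniteDimensional k (T ⟶ A)] :
    ∃ (n : ℕ) (b : (⨁ (fun _ : Fin n => T)) ⟶ A), ∀ g : T ⟶ A, ∃ t, g = t ≫ b := by
  let e := Module.finBasis k (T ⟶ A)
  refine ⟨_, biproduct.desc fun i => e i,
    fun g => ⟨biproduct.lift fun i => e.repr g i • 𝟙 T, ?_⟩⟩
  rw [biproduct.lift_desc]
  simp [e.sum_repr g]

/-- A map commuting with the action of `End T` is given by a morphism on every finite power of
`T`. -/
theorem exists_comp_eq_of_power {T A B : C} (φ : (T ⟶ A) →+ (T ⟶ B))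
    (hφ : ∀ (f : End T) (g : T ⟶ A), φ (f ≫ g) = f ≫ φ g) {n : ℕ}
    (b : (⨁ (fun _ : Fin n => T)) ⟶ A) :
    ∃ c : (⨁ (fun _ : Fin n => T)) ⟶ B, ∀ t, φ (t ≫ b) = t ≫ c := by
  refine ⟨biproduct.desc fun i => φ (biproduct.ι (fun _ : Fin n => T) i ≫ b), fun t => ?_⟩
  have ht : t = ∑ i, (t ≫ biproduct.π _ i) ≫ biproduct.ι (fun _ : Fin n => T) i := by
    simp only [Category.assoc, ← Preadditive.comp_sum, biproduct.total, Category.comp_id]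
  rw [ht, Preadditive.sum_comp, Preadditive.sum_comp, map_sum]
  refine Finset.sum_congr rfl fun i _ => ?_
  rw [Category.assoc _ _ b, Category.assoc _ _ (biproduct.desc _), biproduct.ι_desc]
  exact hφ _ _

/-- If `T` is rigid, then every morphism from `T` to the suspension of a finite power of `T`
vanishes. -/
theorem IsRigid.eq_zero_of_power [HasShift C ℤ] [∀ n : ℤ, (shiftFunctor C n).Additive]
    {T : C} (hT : IsRigid T) {n : ℕ}
    (f : T ⟶ (⨁ (fun _ : Fin n => T))⟦(1 : ℤ)⟧) : f = 0 := by
  have h : f = f ≫ (𝟙 (⨁ (fun _ : Fin n => T)))⟦(1 : ℤ)⟧' := by simp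
  rw [h, ← biproduct.total, Functor.map_sum, Preadditive.comp_sum]
  refine Finset.sum_eq_zero fun j _ => ?_
  rw [Functor.map_comp, ← Category.assoc, hT (f ≫ _), zero_comp]

end FinitePower

section AddClosure

variable {C : Type u} [Category.{v} C] [Preadditive C] [HasZeroObject C]
  [HasShift C ℤ] [∀ n : ℤ, (shiftFunctor C n).Additive] [Pretriangulated C]
  [HasFiniteBiproducts C]

/-- A morphism out of an object of `add T` vanishes as soon as it vanishes on all morphisms
from `T`. -/
theorem InAdd.eq_zero_of_forall_comp_eq_zero {T A B : C} (hA : InAdd T A) (f : A ⟶ B)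
    (hf : ∀ t : T ⟶ A, t ≫ f = 0) : f = 0 := by
  obtain ⟨n, Z, ⟨e⟩⟩ := hA
  have h : e.inv ≫ biprod.fst ≫ f = 0 := by
    refine biproduct.hom_ext' _ _ fun j => ?_
    simpa using hf (biproduct.ι (fun _ : Fin n => T) j ≫ e.inv ≫ biprod.fst)
  calc f = biprod.inl ≫ e.hom ≫ e.inv ≫ biprod.fst ≫ f := by simp
    _ = 0 := by rw [h]; simp

/-- If `T` is cluster-tilting, the cocone of a right approximation by a finite power of `T` lies
in `add T`. -/
theorem IsClusterTilting.inAdd_of_distinguished {T : C} (hT : IsClusterTilting T)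
    {n : ℕ} {Z A : C} {a : Z ⟶ ⨁ (fun _ : Fin n => T)}
    {b : (⨁ (fun _ : Fin n => T)) ⟶ A} {d : A ⟶ Z⟦(1 : ℤ)⟧}
    (hd : Triangle.mk a b d ∈ distTriang C) (hb : ∀ g : T ⟶ A, ∃ t, g = t ≫ b) :
    InAdd T Z := by
  refine hT.2 Z fun f => ?_
  obtain ⟨g, rfl⟩ := Triangle.coyoneda_exact₁ _ hd f (hT.1.eq_zero_of_power _)
  obtain ⟨t, rfl⟩ := hb g
  have hbd : b ≫ d = 0 := comp_distTriang_mor_zero₂₃ _ hd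
  change (t ≫ b) ≫ d = 0
  rw [Category.assoc, hbd, comp_zero]

end AddClosure

theorem H_full
    (k : Type*) [Field k]
    (C : Type u) [Category.{v} C] [Preadditive C] [Linear k C] [HasZeroObject C]
    [HasShift C ℤ] [∀ n : ℤ, (shiftFunctor C n).Additive] [Pretriangulated C]
    [HasFiniteBiproducts C] [IsIdempotentComplete C]
    (hfd : ∀ X Y : C, FiniteDimensional k (X ⟶ Y))
    (cy : TwoCYStructure k C)
    (T : C) (hT : IsClusterTilting T)
    (X Y : C)
    (φ : (T ⟶ X⟦(1 : ℤ)⟧) →+ (T ⟶ Y⟦(1 : ℤ)⟧))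
    (hφ : ∀ (f : End T) (g : T ⟶ X⟦(1 : ℤ)⟧), φ (f ≫ g) = f ≫ φ g) :
    ∃ f : X ⟶ Y, ∀ g : T ⟶ X⟦(1 : ℤ)⟧, φ g = g ≫ f⟦(1 : ℤ)⟧' := by
  have := hfd T (X⟦(1 : ℤ)⟧)
  obtain ⟨n, b, hb⟩ := exists_power_approximation k T (X⟦(1 : ℤ)⟧)
  obtain ⟨Z, a, d, hd⟩ := distinguished_cocone_triangle₁ b
  obtain ⟨c, hc⟩ := exists_comp_eq_of_power φ hφ b
  have hab : a ≫ b = 0 := comp_distTriang_mor_zero₁₂ _ hd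
  have hac : a ≫ c = 0 :=
    (hT.inAdd_of_distinguished hd hb).eq_zero_of_forall_comp_eq_zero _ fun t => by
      rw [← Category.assoc, ← hc, Category.assoc, hab, comp_zero, map_zero]
  obtain ⟨h, hbh⟩ : ∃ h : X⟦(1 : ℤ)⟧ ⟶ Y⟦(1 : ℤ)⟧, c = b ≫ h :=
    Triangle.yoneda_exact₂ _ hd c hac
  obtain ⟨f, rfl⟩ := (shiftFunctor C (1 : ℤ)).map_surjective h
  refine ⟨f, fun g => ?_⟩
  obtain ⟨t, rfl⟩ := hb g
  rw [hc, hbh, Category.assoc]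
end

section
/- Let C be as in the 2-Calabi–Yau setup and T a cluster-tilting object of C. The functor H = Hom_C(T, Σ−) induces an equivalence of k-linear categories between the quotient category C/(T), where (T) is the ideal of morphisms factoring through an object of add T, and the category of finite-dimensional right End_C(T)-modules. -/
/-!
STATEMENT 11 (Keller–Reiten / Buan–Marsh–Reiten): In the 2-Calabi–Yau setup, for a
cluster-tilting object `T`, the functor `H = Hom_C(T, Σ−)` induces an equivalence
between the quotient category `C/(T)` (where `(T)` is the ideal of morphisms factoring
through `add T`) and the category of finite-dimensional right `End_C(T)`-modules.

This is formalized as: there is an equivalence `F` from the quotient of `C` by the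
ideal of morphisms factoring through `add T` to the category of finite
(equivalently, finite-dimensional) right `End_C(T)`-modules, together with
identifications `F(X) ≅ Hom_C(T, ΣX)` of right `End_C(T)`-modules under which `F`
acts on morphisms as `H` does, i.e. by postcomposition with `Σf`.

Krull–Schmidt is encoded as idempotent completeness, which, together with
Hom-finiteness over the field `k`, is equivalent to the Krull–Schmidt property.
-/
open CategoryTheory Limits Pretriangulated

universe v u

/-- The ideal of morphisms factoring through `add T`, as a `HomRel`:
`f ~ g` iff `f - g` factors through an object of `add T`. -/
def addTRel {C : Type u} [Category.{v} C] [Preadditive C] [HasZeroObject C]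
    [HasShift C ℤ] [∀ n : ℤ, (shiftFunctor C n).Additive] [Pretriangulated C]
    [HasFiniteBiproducts C] (T : C) : HomRel C :=
  fun {X Y} f g => ∃ (M : C) (a : X ⟶ M) (b : M ⟶ Y), InAdd T M ∧ f - g = a ≫ b

section ClusterTilting

variable {C : Type u} [Category.{v} C] [Preadditive C]

lemma finite_hom_of_finiteDimensional (k : Type*) [Field k] [Linear k C]
    (hfd : ∀ X Y : C, FiniteDimensional k (X ⟶ Y)) (T Y : C) :
    Module.Finite (End T)ᵐᵒᵖ (T ⟶ Y) := by
  have : IsScalarTower k (End T)ᵐᵒᵖ (T ⟶ Y) := ⟨fun a b f => Linear.smul_comp _ _ _ a b.unop f⟩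
  have := hfd T Y
  exact Module.Finite.of_restrictScalars_finite k (End T)ᵐᵒᵖ (T ⟶ Y)

lemma isNoetherianRing_end_op (k : Type*) [Field k] [Linear k C]
    (hfd : ∀ X Y : C, FiniteDimensional k (X ⟶ Y)) (T : C) :
    IsNoetherianRing (End T)ᵐᵒᵖ := by
  have : Module.Finite k (End T) := hfd T T
  have : Module.Finite k (End T)ᵐᵒᵖ := Module.Finite.equiv (MulOpposite.opLinearEquiv k)
  exact IsNoetherianRing.of_finite k _

variable [HasFiniteBiproducts C]

/-- A linear map out of `Hom(T, -)` is computed on `t ≫ p`, for `t` a morphism to a sum of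
copies of `T`, by composing with the induced morphism out of this sum. -/
lemma comp_desc_eq_linearMap {T Y Y' : C} {n : ℕ} (p : (⨁ fun _ : Fin n => T) ⟶ Y)
    (φ : (T ⟶ Y) →ₗ[(End T)ᵐᵒᵖ] (T ⟶ Y')) (t : T ⟶ ⨁ fun _ : Fin n => T) :
    t ≫ biproduct.desc (fun i => φ (biproduct.ι (fun _ : Fin n => T) i ≫ p)) = φ (t ≫ p) := by
  have ht : t = ∑ i, (t ≫ biproduct.π _ i) ≫ biproduct.ι (fun _ : Fin n => T) i := by
    conv_lhs => rw [← Category.comp_id t, ← biproduct.total, Preadditive.comp_sum]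
    simp
  have h (i : Fin n) : φ (((t ≫ biproduct.π _ i) ≫ biproduct.ι (fun _ : Fin n => T) i) ≫ p) =
      (t ≫ biproduct.π _ i) ≫ φ (biproduct.ι (fun _ : Fin n => T) i ≫ p) := by
    rw [Category.assoc]
    exact φ.map_smul (MulOpposite.op (t ≫ biproduct.π _ i : T ⟶ T) : (End T)ᵐᵒᵖ) _
  conv_lhs => rw [ht]
  conv_rhs => rw [ht]
  simp only [Preadditive.sum_comp, map_sum, h]
  simp

/-- Composing with `p` the morphism with coordinates `v` gives a linear combination of the
components of `p`. -/
lemma lift_comp_eq_linearCombination {T Y : C} {n : ℕ} (p : (⨁ fun _ : Fin n => T) ⟶ Y)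
    (v : Fin n → (End T)ᵐᵒᵖ) :
    biproduct.lift (fun i => ((v i).unop : T ⟶ T)) ≫ p =
      Fintype.linearCombination (End T)ᵐᵒᵖ
        (fun i => biproduct.ι (fun _ : Fin n => T) i ≫ p) v := by
  rw [biproduct.lift_eq, Preadditive.sum_comp, Fintype.linearCombination_apply]
  simp [End.smul_left]

lemma exists_fin_generators (k : Type*) [Field k] [Linear k C]
    (hfd : ∀ X Y : C, FiniteDimensional k (X ⟶ Y)) (T Y : C) :
    ∃ (n : ℕ) (p : (⨁ fun _ : Fin n => T) ⟶ Y), ∀ f : T ⟶ Y, ∃ t, t ≫ p = f := by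
  have := finite_hom_of_finiteDimensional k hfd T Y
  obtain ⟨n, s, hs⟩ := Module.Finite.exists_fin (R := (End T)ᵐᵒᵖ) (M := T ⟶ Y)
  refine ⟨n, biproduct.desc s, fun f => ?_⟩
  have hf : f ∈ Submodule.span (End T)ᵐᵒᵖ (Set.range s) := hs ▸ Submodule.mem_top
  obtain ⟨c, hc⟩ := (Submodule.mem_span_range_iff_exists_fun _).1 hf
  refine ⟨_, (lift_comp_eq_linearCombination _ c).trans ?_⟩
  simpa [Fintype.linearCombination_apply] using hc

variable [HasZeroObject C] [HasShift C ℤ] [∀ n : ℤ, (shiftFunctor C n).Additive]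
  [Pretriangulated C]

lemma inAdd_biproduct (T : C) (n : ℕ) : InAdd T (⨁ fun _ : Fin n => T) :=
  ⟨n, _, ⟨(isoBiprodZero (isZero_zero C)).symm⟩⟩

lemma InAdd.exists_id_eq_sum {T M : C} (h : InAdd T M) :
    ∃ (n : ℕ) (p : Fin n → (M ⟶ T)) (q : Fin n → (T ⟶ M)), 𝟙 M = ∑ i, p i ≫ q i := by
  obtain ⟨n, Y, ⟨e⟩⟩ := h
  refine ⟨n, fun i => biprod.inl ≫ e.hom ≫ biproduct.π _ i,
    fun i => biproduct.ι (fun _ : Fin n => T) i ≫ e.inv ≫ biprod.fst, ?_⟩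
  calc 𝟙 M = biprod.inl ≫ e.hom ≫ 𝟙 _ ≫ e.inv ≫ biprod.fst := by simp
    _ = _ := by
      rw [← biproduct.total]
      simp only [Preadditive.sum_comp, Preadditive.comp_sum, Category.assoc]

/-- Morphisms out of an object of `add T` are detected by `Hom(T, -)`. -/
lemma InAdd.eq_zero_of_forall_comp {T M Y : C} (h : InAdd T M) (f : M ⟶ Y)
    (hf : ∀ t : T ⟶ M, t ≫ f = 0) : f = 0 := by
  obtain ⟨n, p, q, e⟩ := h.exists_id_eq_sum
  rw [← Category.id_comp f, e, Preadditive.sum_comp]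
  simp [hf]

lemma IsRigid.eq_zero_of_inAdd {T M : C} (hT : IsRigid T) (h : InAdd T M)
    (f : T ⟶ M⟦(1 : ℤ)⟧) : f = 0 := by
  obtain ⟨n, p, q, e⟩ := h.exists_id_eq_sum
  have : f ≫ (𝟙 M)⟦(1 : ℤ)⟧' = 0 := by
    rw [e, Functor.map_sum, Preadditive.comp_sum]
    refine Finset.sum_eq_zero fun i _ => ?_
    rw [Functor.map_comp, ← Category.assoc, hT (f ≫ (p i)⟦(1 : ℤ)⟧'), zero_comp]
  simpa using this

/-- Every object `Y` fits in a distinguished triangle `Z ⟶ T₀ ⟶ Y ⟶ Z⟦1⟧` where `Z` is in `add T`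
and `T₀ ⟶ Y` is an approximation of `Y` by a sum of copies of `T`. -/
lemma IsClusterTilting.exists_approximation {T : C} (hT : IsClusterTilting T)
    (k : Type*) [Field k] [Linear k C] (hfd : ∀ X Y : C, FiniteDimensional k (X ⟶ Y)) (Y : C) :
    ∃ (n : ℕ) (Z : C) (z : Z ⟶ ⨁ fun _ : Fin n => T) (p : (⨁ fun _ : Fin n => T) ⟶ Y)
      (d : Y ⟶ Z⟦(1 : ℤ)⟧), Triangle.mk z p d ∈ distTriang C ∧ InAdd T Z ∧
        ∀ f : T ⟶ Y, ∃ t, t ≫ p = f := by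
  obtain ⟨n, p, hp⟩ := exists_fin_generators k hfd T Y
  obtain ⟨Z, z, d, h⟩ := distinguished_cocone_triangle₁ p
  refine ⟨n, Z, z, p, d, h, hT.2 _ fun f => ?_, hp⟩
  obtain ⟨g, hg⟩ := Triangle.coyoneda_exact₁ _ h f
    (hT.1.eq_zero_of_inAdd (inAdd_biproduct T n) _)
  obtain ⟨t, rfl⟩ := hp g
  have hpd : p ≫ d = 0 := comp_distTriang_mor_zero₂₃ _ h
  refine hg.trans ?_
  change (t ≫ p) ≫ d = 0
  rw [Category.assoc, hpd, comp_zero]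

/-- A linear map between values of `Hom(T, -)` is induced by a morphism. -/
lemma IsClusterTilting.exists_comp_eq {T : C} (hT : IsClusterTilting T)
    (k : Type*) [Field k] [Linear k C] (hfd : ∀ X Y : C, FiniteDimensional k (X ⟶ Y)) {Y Y' : C}
    (φ : (T ⟶ Y) →ₗ[(End T)ᵐᵒᵖ] (T ⟶ Y')) : ∃ w : Y ⟶ Y', ∀ f, f ≫ w = φ f := by
  obtain ⟨n, Z, z, p, d, h, hZ, hp⟩ := hT.exists_approximation k hfd Y
  have hzp : z ≫ p = 0 := comp_distTriang_mor_zero₁₂ _ h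
  obtain ⟨w, hw⟩ := Triangle.yoneda_exact₂ _ h
    (biproduct.desc fun i => φ (biproduct.ι (fun _ : Fin n => T) i ≫ p))
    (hZ.eq_zero_of_forall_comp _ fun t => by
      change t ≫ z ≫ _ = 0
      rw [← Category.assoc, comp_desc_eq_linearMap, Category.assoc, hzp, comp_zero, map_zero])
  refine ⟨w, fun f => ?_⟩
  obtain ⟨t, rfl⟩ := hp f
  rw [← comp_desc_eq_linearMap, hw]
  exact Category.assoc _ _ _

/-- A morphism killed by `Hom(T, -)` factors through the shift of an object of `add T`. -/
lemma IsClusterTilting.exists_factorization {T : C} (hT : IsClusterTilting T)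
    (k : Type*) [Field k] [Linear k C] (hfd : ∀ X Y : C, FiniteDimensional k (X ⟶ Y)) {Y Y' : C}
    (w : Y ⟶ Y') (hw : ∀ f : T ⟶ Y, f ≫ w = 0) :
    ∃ (Z : C) (a : Y ⟶ Z⟦(1 : ℤ)⟧) (b : Z⟦(1 : ℤ)⟧ ⟶ Y'), InAdd T Z ∧ w = a ≫ b := by
  obtain ⟨n, Z, z, p, d, h, hZ, -⟩ := hT.exists_approximation k hfd Y
  obtain ⟨b, hb⟩ := Triangle.yoneda_exact₃ _ h w
    ((inAdd_biproduct T n).eq_zero_of_forall_comp _ fun t =>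
      (Category.assoc _ _ _).symm.trans (hw _))
  exact ⟨Z, d, b, hZ, hb⟩

/-- Every finitely generated module is of the form `Hom(T, Y)`. -/
lemma IsRigid.exists_linearEquiv {T : C} (hT : IsRigid T) [IsNoetherianRing (End T)ᵐᵒᵖ]
    (M : Type*) [AddCommGroup M] [Module (End T)ᵐᵒᵖ M] [Module.Finite (End T)ᵐᵒᵖ M] :
    ∃ Y : C, Nonempty ((T ⟶ Y) ≃ₗ[(End T)ᵐᵒᵖ] M) := by
  obtain ⟨n, f, hf⟩ := Module.Finite.exists_fin' (End T)ᵐᵒᵖ M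
  obtain ⟨m, s, hs⟩ := Submodule.fg_iff_exists_fin_generating_family.1
    (IsNoetherian.noetherian (LinearMap.ker f))
  let z : (⨁ fun _ : Fin m => T) ⟶ ⨁ fun _ : Fin n => T :=
    biproduct.desc fun j => biproduct.lift fun i => ((s j i).unop : T ⟶ T)
  obtain ⟨Y, p, d, h⟩ := distinguished_cocone_triangle z
  let P := Fintype.linearCombination (End T)ᵐᵒᵖ fun i => biproduct.ι (fun _ : Fin n => T) i ≫ p
  have hP (v) : P v = biproduct.lift (fun i => ((v i).unop : T ⟶ T)) ≫ p :=
    (lift_comp_eq_linearCombination p v).symm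
  have hsurj : Function.Surjective P := fun g => by
    obtain ⟨t, ht⟩ := Triangle.coyoneda_exact₃ _ h g
      (hT.eq_zero_of_inAdd (inAdd_biproduct T m) _)
    refine ⟨fun i => MulOpposite.op (t ≫ biproduct.π (fun _ : Fin n => T) i : T ⟶ T), ?_⟩
    rw [hP]
    refine Eq.trans ?_ ht.symm
    change _ ≫ p = t ≫ p
    congr 1
    exact biproduct.hom_ext _ _ fun i => biproduct.lift_π _ i
  have hzero (v : Fin n → (End T)ᵐᵒᵖ) (c : Fin m → (End T)ᵐᵒᵖ) : (∑ j, c j • s j = v) ↔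
      biproduct.lift (fun j => ((c j).unop : T ⟶ T)) ≫ z =
        biproduct.lift (fun i => ((v i).unop : T ⟶ T)) := by
    have hc : biproduct.lift (fun j => ((c j).unop : T ⟶ T)) ≫ z =
        biproduct.lift (fun i => (((∑ j, c j • s j) i).unop : T ⟶ T)) := by
      ext i
      simp [z, biproduct.lift_desc, Preadditive.sum_comp, End.mul_def]
    rw [hc]
    refine ⟨fun e => by rw [e], fun e => ?_⟩
    funext i
    have := congrArg (· ≫ biproduct.π (fun _ : Fin n => T) i) e
    simp only [biproduct.lift_π] at this
    exact MulOpposite.unop_injective this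
  have hker : LinearMap.ker P = LinearMap.ker f := by
    rw [← hs]
    ext v
    rw [LinearMap.mem_ker, hP, Submodule.mem_span_range_iff_exists_fun]
    simp only [hzero]
    constructor
    · intro hv
      obtain ⟨t, ht⟩ := Triangle.coyoneda_exact₂ _ h _ hv
      refine ⟨fun i => MulOpposite.op (t ≫ biproduct.π (fun _ : Fin m => T) i : T ⟶ T), ?_⟩
      refine Eq.trans ?_ ht.symm
      change _ ≫ z = t ≫ z
      congr 1
      exact biproduct.hom_ext _ _ fun i => biproduct.lift_π _ i
    · rintro ⟨c, hc⟩
      have hzp : z ≫ p = 0 := comp_distTriang_mor_zero₁₂ _ h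
      rw [← hc, Category.assoc, hzp, comp_zero]
  exact ⟨Y, ⟨(P.quotKerEquivOfSurjective hsurj).symm ≪≫ₗ
    Submodule.quotEquivOfEq _ _ hker ≪≫ₗ f.quotKerEquivOfSurjective hf⟩⟩

end ClusterTilting

theorem H_induces_equivalence
    (k : Type*) [Field k]
    (C : Type u) [Category.{v} C] [Preadditive C] [Linear k C] [HasZeroObject C]
    [HasShift C ℤ] [∀ n : ℤ, (shiftFunctor C n).Additive] [Pretriangulated C]
    [HasFiniteBiproducts C] [IsIdempotentComplete C]
    (hfd : ∀ X Y : C, FiniteDimensional k (X ⟶ Y))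
    (cy : TwoCYStructure k C)
    (T : C) (hT : IsClusterTilting T) :
    ∃ (F : CategoryTheory.Quotient (addTRel T) ⥤ FGModuleCat.{v} (End T)ᵐᵒᵖ)
      (e : ∀ X : C,
        ((F.obj ((Quotient.functor (addTRel T)).obj X)) : Type v) ≃+
          (T ⟶ X⟦(1 : ℤ)⟧)),
      F.IsEquivalence ∧
      -- the identifications `e X` are right `End_C(T)`-module isomorphisms,
      -- where `End_C(T)` acts on `Hom_C(T, ΣX)` by precomposition
      (∀ (X : C) (f : End T) (m : F.obj ((Quotient.functor (addTRel T)).obj X)),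
        e X (MulOpposite.op f • m) = f ≫ e X m) ∧
      -- under these identifications, `F` acts on morphisms by postcomposition
      -- with `Σf`, i.e. `F` is induced by `H = Hom_C(T, Σ−)`
      (∀ (X Y : C) (f : X ⟶ Y)
        (m : F.obj ((Quotient.functor (addTRel T)).obj X)),
        e Y ((F.map ((Quotient.functor (addTRel T)).map f)) m) =
          e X m ≫ f⟦(1 : ℤ)⟧') := by
  have hfin (Y : C) := finite_hom_of_finiteDimensional k hfd T Y
  have := isNoetherianRing_end_op k hfd T
  let H : C ⥤ FGModuleCat.{v} (End T)ᵐᵒᵖ :=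
    ObjectProperty.lift _ (shiftFunctor C (1 : ℤ) ⋙ preadditiveCoyonedaObj T) fun X => hfin _
  have hmap {X Y : C} (f g : X ⟶ Y) : H.map f = H.map g ↔
      ∀ m : T ⟶ X⟦(1 : ℤ)⟧, m ≫ (f - g)⟦(1 : ℤ)⟧' = 0 := by
    have h (m : T ⟶ X⟦(1 : ℤ)⟧) : m ≫ (f - g)⟦(1 : ℤ)⟧' = 0 ↔
        m ≫ f⟦(1 : ℤ)⟧' = m ≫ g⟦(1 : ℤ)⟧' := by
      rw [Functor.map_sub, Preadditive.comp_sub, sub_eq_zero]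
    simp only [h]
    exact ⟨fun e m => congrArg (fun φ : H.obj X ⟶ H.obj Y => φ.hom.hom m) e,
      fun e => FGModuleCat.hom_ext (LinearMap.ext e)⟩
  have hrel (X Y : C) (f g : X ⟶ Y) (hfg : addTRel T f g) : H.map f = H.map g := by
    obtain ⟨M, a, b, hM, hab⟩ := hfg
    refine (hmap f g).2 fun m => ?_
    rw [hab, Functor.map_comp, ← Category.assoc, hT.1.eq_zero_of_inAdd hM (m ≫ a⟦(1 : ℤ)⟧'),
      zero_comp]
  let F := CategoryTheory.Quotient.lift (addTRel T) H hrel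
  have hfaithful : F.Faithful := ⟨fun {X Y} f g hfg => by
    obtain ⟨f, rfl⟩ := (Quotient.functor (addTRel T)).map_surjective f
    obtain ⟨g, rfl⟩ := (Quotient.functor (addTRel T)).map_surjective g
    change H.map f = H.map g at hfg
    obtain ⟨Z, a, b, hZ, hab⟩ := hT.exists_factorization k hfd ((f - g)⟦(1 : ℤ)⟧')
      ((hmap f g).1 hfg)
    refine CategoryTheory.Quotient.sound _ ⟨Z, (shiftFunctor C (1 : ℤ)).preimage a,
      (shiftFunctor C (1 : ℤ)).preimage b, hZ, (shiftFunctor C (1 : ℤ)).map_injective ?_⟩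
    simpa using hab⟩
  have hfull : F.Full := ⟨fun {X Y} φ => by
    obtain ⟨w, hw⟩ := hT.exists_comp_eq k hfd (Y := X.as⟦(1 : ℤ)⟧) (Y' := Y.as⟦(1 : ℤ)⟧) φ.hom.hom
    refine ⟨(Quotient.functor (addTRel T)).map ((shiftFunctor C (1 : ℤ)).preimage w), ?_⟩
    refine FGModuleCat.hom_ext (LinearMap.ext fun m => Eq.trans ?_ (hw m))
    change m ≫ ((shiftFunctor C (1 : ℤ)).preimage w)⟦(1 : ℤ)⟧' = _
    rw [Functor.map_preimage]⟩
  have hsurj : F.EssSurj := ⟨fun M => by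
    obtain ⟨Y, ⟨φ⟩⟩ := hT.1.exists_linearEquiv M
    have := hfin
    let i := (shiftFunctor C (1 : ℤ)).objObjPreimageIso Y
    let ψ : (T ⟶ ((shiftFunctor C (1 : ℤ)).objPreimage Y)⟦(1 : ℤ)⟧) ≃ₗ[(End T)ᵐᵒᵖ] M :=
      ((preadditiveCoyonedaObj T).mapIso i).toLinearEquiv ≪≫ₗ φ
    exact ⟨(Quotient.functor (addTRel T)).obj ((shiftFunctor C (1 : ℤ)).objPreimage Y),
      ⟨ψ.toFGModuleCatIso⟩⟩⟩
  exact ⟨F, fun X => AddEquiv.refl _, { }, fun _ _ _ => rfl, fun _ _ _ _ => rfl⟩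
end
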